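/- arXiv:1606.04479 — 2 statements merged into one kernel-verified Lean document; each statement's English description precedes it below -/
import Mathlib

section
/- Let β > 0 and let F : ℕ → (0,∞) satisfy F(N)/N → ∞ as N → ∞ (strong supercritical force). Then there exist a constant C > 0 and N₀ ∈ ℕ such that for all N ≥ N₀, the conditional variance of the first spacing satisfies 0 ≤ v_1(N, F(N)) ≤ C·F(N)^{−3/2}. -/
open MeasureTheory Filter

noncomputable section

/-- The `k`-th spacing coordinate (for `1 ≤ k ≤ N`): for `k ≤ N-1` it is the
`k`-th coordinate of `x`, and for `k = N` it is `1 - (x_1 + ⋯ + x_{N-1})`. -/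
def coulombCoord (N k : ℕ) (x : Fin (N - 1) → ℝ) : ℝ :=
  if h : k - 1 < N - 1 then x ⟨k - 1, h⟩ else 1 - ∑ i, x i

/-- The open simplex `T_N ⊆ (0,1)^{N-1}`. -/
def coulombDomain (N : ℕ) : Set (Fin (N - 1) → ℝ) :=
  {x | (∀ i, 0 < x i ∧ x i < 1) ∧ ∑ i, x i < 1}

/-- `I_N[g] = ∫_{T_N} g · exp(−Σ_{i=1}^N (β/x_i + F·i·x_i))`. -/
def coulombInt (β F : ℝ) (N : ℕ) (g : (Fin (N - 1) → ℝ) → ℝ) : ℝ :=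
  ∫ x in coulombDomain N,
    g x * Real.exp (-(∑ k ∈ Finset.Icc 1 N,
      (β / coulombCoord N k x + F * (k : ℝ) * coulombCoord N k x)))

/-- Conditional mean `m_k(N,F)` of the `k`-th spacing. -/
def condMean (β : ℝ) (N : ℕ) (F : ℝ) (k : ℕ) : ℝ :=
  coulombInt β F N (coulombCoord N k) / coulombInt β F N (fun _ => 1)

/-- Conditional variance `v_k(N,F)` of the `k`-th spacing. -/
def condVar (β : ℝ) (N : ℕ) (F : ℝ) (k : ℕ) : ℝ :=
  coulombInt β F N (fun x => coulombCoord N k x ^ 2) / coulombInt β F N (fun _ => 1)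
    - condMean β N F k ^ 2


def cwt (β a z : ℝ) : ℝ := Real.exp (-(β / z + a * z))

lemma cwt_pos (β a z : ℝ) : 0 < cwt β a z := Real.exp_pos _

lemma cwt_meas (β a : ℝ) : Measurable (cwt β a) := by
  unfold cwt; fun_prop

lemma cwt_le {β a z : ℝ} (hβ : 0 < β) (hz : 0 < z) : cwt β a z ≤ Real.exp (-a * z) := by
  unfold cwt
  apply Real.exp_le_exp.2
  have : 0 < β / z := by positivity
  linarith

lemma cwt_div_le {β a z : ℝ} (hβ : 0 < β) (hz : 0 < z) :
    cwt β a z / z ≤ 1 / β * Real.exp (-a * z) := by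
  have h1 : cwt β a z = Real.exp (-(β / z)) * Real.exp (-a * z) := by
    unfold cwt; rw [← Real.exp_add]; congr 1; ring
  have h2 : Real.exp (-(β / z)) / z ≤ 1 / β := by
    rw [Real.exp_neg, div_le_div_iff₀ hz hβ]
    have h3 : β / z ≤ Real.exp (β / z) := by
      have := Real.add_one_le_exp (β / z); linarith
    rw [inv_mul_le_iff₀ (Real.exp_pos _)]
    rw [div_le_iff₀ hz] at h3
    linarith
  rw [h1, mul_div_right_comm]
  exact mul_le_mul_of_nonneg_right h2 (Real.exp_pos _).le

lemma exp_int (n : ℕ) {a : ℝ} (ha : 0 < a) :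
    IntegrableOn (fun z : ℝ => z ^ n * Real.exp (-a * z)) (Set.Ioi 0) := by
  have := integrableOn_rpow_mul_exp_neg_mul_rpow (p := 1) (s := n) (b := a)
    (by have : (0:ℝ) ≤ n := Nat.cast_nonneg n
        linarith) one_pos ha
  simpa using this

lemma cwt_int (n : ℕ) {β a : ℝ} (hβ : 0 < β) (ha : 0 < a) :
    IntegrableOn (fun z : ℝ => z ^ n * cwt β a z) (Set.Ioi 0) := by
  refine (exp_int n ha).mono' (by have := cwt_meas β a; fun_prop) ?_
  filter_upwards [ae_restrict_mem measurableSet_Ioi] with z hz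
  have hz : 0 < z := hz
  rw [Real.norm_of_nonneg (mul_nonneg (by positivity) (cwt_pos _ _ _).le)]
  exact mul_le_mul_of_nonneg_left (cwt_le hβ hz) (by positivity)

lemma cwt_div_int {β a : ℝ} (hβ : 0 < β) (ha : 0 < a) :
    IntegrableOn (fun z : ℝ => cwt β a z / z) (Set.Ioi 0) := by
  have h0 : IntegrableOn (fun z : ℝ => 1 / β * Real.exp (-a * z)) (Set.Ioi 0) := by
    have := (exp_int 0 ha).const_mul (1 / β)
    simpa [IntegrableOn] using this
  refine h0.mono' ((cwt_meas β a).div measurable_id).aestronglyMeasurable ?_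
  filter_upwards [ae_restrict_mem measurableSet_Ioi] with z hz
  have hz : 0 < z := hz
  rw [Real.norm_of_nonneg (div_nonneg (cwt_pos _ _ _).le hz.le)]
  exact cwt_div_le hβ hz

lemma cwt_deriv (n : ℕ) {β a z : ℝ} (hz : 0 < z) :
    HasDerivAt (fun z => z ^ n * cwt β a z)
      (n * z ^ (n - 1) * cwt β a z + z ^ n * (cwt β a z * (β / z ^ 2 - a))) z := by
  have h1 : HasDerivAt (fun z : ℝ => -(β / z + a * z)) (β / z ^ 2 - a) z := by
    have h := (((hasDerivAt_inv hz.ne').const_mul β).add ((hasDerivAt_id z).const_mul a)).neg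
    convert! h using 1
    field_simp
    ring
  exact (hasDerivAt_pow n z).mul h1.exp

lemma cwt_ibp (n : ℕ) (hn : n ≠ 0) {β a : ℝ} (hβ : 0 < β) (ha : 0 < a)
    (hi : IntegrableOn (fun z => n * z ^ (n - 1) * cwt β a z
      + z ^ n * (cwt β a z * (β / z ^ 2 - a))) (Set.Ioi 0)) :
    ∫ z in Set.Ioi 0, (n * z ^ (n - 1) * cwt β a z + z ^ n * (cwt β a z * (β / z ^ 2 - a))) = 0 := by
  have := integral_Ioi_of_hasDerivAt_of_tendsto (f := fun z => z ^ n * cwt β a z) (a := 0) (m := 0)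
    ?_ (fun z hz => cwt_deriv n hz) hi ?_
  · rw [this]; simp [hn]
  · unfold ContinuousWithinAt
    have h0 : (0:ℝ) ^ n * cwt β a 0 = 0 := by simp [hn]
    simp only [h0]
    have hc : Tendsto (fun z : ℝ => z ^ n * Real.exp (-a * z)) (nhdsWithin 0 (Set.Ici 0)) (nhds 0) := by
      have : Continuous (fun z : ℝ => z ^ n * Real.exp (-a * z)) := by fun_prop
      have h2 := this.tendsto 0
      simp only [ne_eq, hn, not_false_eq_true, zero_pow, zero_mul] at h2
      exact h2.mono_left nhdsWithin_le_nhds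
    refine squeeze_zero' ?_ ?_ hc
    · filter_upwards [self_mem_nhdsWithin] with z hz
      exact mul_nonneg (pow_nonneg hz n) (cwt_pos _ _ _).le
    · filter_upwards [self_mem_nhdsWithin] with z hz
      rcases eq_or_lt_of_le (show (0:ℝ) ≤ z from hz) with h | h
      · subst h; simp [hn]
      · exact mul_le_mul_of_nonneg_left (cwt_le hβ h) (by positivity)
  · have hc : Tendsto (fun z : ℝ => z ^ n * Real.exp (-a * z)) atTop (nhds 0) := by
      have := tendsto_rpow_mul_exp_neg_mul_atTop_nhds_zero n a ha
      simpa using this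
    refine squeeze_zero' ?_ ?_ hc
    · filter_upwards [eventually_gt_atTop 0] with z hz
      exact mul_nonneg (pow_nonneg hz.le n) (cwt_pos _ _ _).le
    · filter_upwards [eventually_gt_atTop 0] with z hz
      exact mul_le_mul_of_nonneg_left (cwt_le hβ hz) (by positivity)

lemma cwt_id2 {β a : ℝ} (hβ : 0 < β) (ha : 0 < a) :
    a * ∫ z in Set.Ioi 0, z ^ 2 * cwt β a z =
      β * (∫ z in Set.Ioi 0, cwt β a z) + 2 * ∫ z in Set.Ioi 0, z * cwt β a z := by
  have i0 := cwt_int 0 hβ ha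
  have i1 := cwt_int 1 hβ ha
  have i2 := cwt_int 2 hβ ha
  simp only [pow_zero, one_mul, pow_one] at i0 i1
  have e : ∀ z ∈ Set.Ioi (0:ℝ), (2:ℕ) * z ^ (2 - 1) * cwt β a z
      + z ^ 2 * (cwt β a z * (β / z ^ 2 - a))
      = 2 * (z * cwt β a z) + β * cwt β a z - a * (z ^ 2 * cwt β a z) := by
    intro z hz
    have hz : z ≠ 0 := ne_of_gt hz
    push_cast
    field_simp
    ring
  have hi := ((i1.const_mul 2).add (i0.const_mul β)).sub (i2.const_mul a)
  have hj : IntegrableOn (fun z => 2 * (z * cwt β a z) + β * cwt β a z) (Set.Ioi 0) :=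
    (i1.const_mul 2).add (i0.const_mul β)
  have h := cwt_ibp 2 (by norm_num) hβ ha
    (IntegrableOn.congr_fun hi (fun z hz => (e z hz).symm) measurableSet_Ioi)
  rw [setIntegral_congr_fun measurableSet_Ioi e, integral_sub hj (i2.const_mul a),
    integral_add (i1.const_mul 2) (i0.const_mul β), integral_const_mul, integral_const_mul,
    integral_const_mul] at h
  linarith

lemma cwt_id1 {β a : ℝ} (hβ : 0 < β) (ha : 0 < a) :
    a * ∫ z in Set.Ioi 0, z * cwt β a z =
      (∫ z in Set.Ioi 0, cwt β a z) + β * ∫ z in Set.Ioi 0, cwt β a z / z := by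
  have i0 := cwt_int 0 hβ ha
  have i1 := cwt_int 1 hβ ha
  have i2 := cwt_div_int hβ ha
  simp only [pow_zero, one_mul, pow_one] at i0 i1
  have e : ∀ z ∈ Set.Ioi (0:ℝ), (1:ℕ) * z ^ (1 - 1) * cwt β a z
      + z ^ 1 * (cwt β a z * (β / z ^ 2 - a))
      = cwt β a z + β * (cwt β a z / z) - a * (z * cwt β a z) := by
    intro z hz
    have hz : z ≠ 0 := ne_of_gt hz
    push_cast
    field_simp
    ring
  have hi := (i0.add (i2.const_mul β)).sub (i1.const_mul a)
  have hj : IntegrableOn (fun z => cwt β a z + β * (cwt β a z / z)) (Set.Ioi 0) :=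
    i0.add (i2.const_mul β)
  have h := cwt_ibp 1 (by norm_num) hβ ha
    (IntegrableOn.congr_fun hi (fun z hz => (e z hz).symm) measurableSet_Ioi)
  rw [setIntegral_congr_fun measurableSet_Ioi e, integral_sub hj (i1.const_mul a),
    integral_add i0 (i2.const_mul β), integral_const_mul, integral_const_mul] at h
  linarith

lemma cwt_Z_pos {β a : ℝ} (hβ : 0 < β) (ha : 0 < a) : 0 < ∫ z in Set.Ioi 0, cwt β a z := by
  have i0 := cwt_int 0 hβ ha
  simp only [pow_zero, one_mul] at i0
  rw [setIntegral_pos_iff_support_of_nonneg_ae (ae_of_all _ fun z => (cwt_pos β a z).le) i0]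
  have : Function.support (cwt β a) = Set.univ := by
    ext z; simp [(cwt_pos β a z).ne']
  rw [this]; simp

/-- normalized density on the line -/
def cden (β a z : ℝ) : ℝ :=
  (Set.Ioi (0:ℝ)).indicator (fun z => cwt β a z / ∫ z in Set.Ioi 0, cwt β a z) z

lemma cden_meas (β a : ℝ) : Measurable (cden β a) := by
  unfold cden
  exact ((cwt_meas β a).div_const _).indicator measurableSet_Ioi

lemma cden_nonneg {β a : ℝ} (hβ : 0 < β) (ha : 0 < a) (z : ℝ) : 0 ≤ cden β a z := by
  unfold cden
  exact Set.indicator_nonneg (fun z _ => div_nonneg (cwt_pos _ _ _).le (cwt_Z_pos hβ ha).le) _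

lemma cden_mul (β a : ℝ) (g : ℝ → ℝ) : (fun z => cden β a z * g z) = 
    (Set.Ioi (0:ℝ)).indicator (fun z => (g z * cwt β a z) / ∫ z in Set.Ioi 0, cwt β a z) := by
  ext z
  unfold cden
  by_cases h : z ∈ Set.Ioi (0:ℝ)
  · simp only [Set.indicator_of_mem h]; ring
  · simp only [Set.indicator_of_notMem h]; ring

def cmu (β a : ℝ) : Measure ℝ := volume.withDensity (fun z => ENNReal.ofReal (cden β a z))

lemma cmu_integral {β a : ℝ} (hβ : 0 < β) (ha : 0 < a) (g : ℝ → ℝ) :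
    ∫ z, g z ∂(cmu β a) = (∫ z in Set.Ioi 0, g z * cwt β a z) / ∫ z in Set.Ioi 0, cwt β a z := by
  unfold cmu
  rw [integral_withDensity_eq_integral_toReal_smul (cden_meas β a).ennreal_ofReal (by simp)]
  simp only [smul_eq_mul, ENNReal.toReal_ofReal (cden_nonneg hβ ha _)]
  rw [cden_mul, integral_indicator measurableSet_Ioi, integral_div]

lemma cden_int {β a : ℝ} (hβ : 0 < β) (ha : 0 < a) : Integrable (cden β a) := by
  have i0 := cwt_int 0 hβ ha
  simp only [pow_zero, one_mul] at i0
  unfold cden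
  exact (integrable_indicator_iff measurableSet_Ioi).2 (i0.div_const _)

lemma cmu_prob {β a : ℝ} (hβ : 0 < β) (ha : 0 < a) : IsProbabilityMeasure (cmu β a) := by
  constructor
  unfold cmu
  rw [withDensity_apply _ MeasurableSet.univ, Measure.restrict_univ, ← ofReal_integral_eq_lintegral_ofReal
    (cden_int hβ ha) (ae_of_all _ (cden_nonneg hβ ha))]
  have := cden_mul β a (fun _ => 1)
  simp only [mul_one, one_mul] at this
  change ENNReal.ofReal (∫ z, cden β a z) = 1
  rw [this, integral_indicator measurableSet_Ioi, integral_div, div_self (cwt_Z_pos hβ ha).ne']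
  simp

lemma cmu_memLp {β a : ℝ} (hβ : 0 < β) (ha : 0 < a) : MemLp (fun z : ℝ => z) 2 (cmu β a) := by
  rw [memLp_two_iff_integrable_sq (by fun_prop)]
  unfold cmu
  rw [integrable_withDensity_iff_integrable_smul' (cden_meas β a).ennreal_ofReal (by simp)]
  simp only [smul_eq_mul, ENNReal.toReal_ofReal (cden_nonneg hβ ha _)]
  rw [cden_mul β a (fun z => z ^ 2)]
  exact (integrable_indicator_iff measurableSet_Ioi).2 ((cwt_int 2 hβ ha).div_const _)

lemma cmu_main {β a : ℝ} (hβ : 0 < β) (ha : 1 ≤ a) :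
    0 ≤ ∫ z, z ∂(cmu β a) ∧
    ∫ z, z ∂(cmu β a) ≤ Real.sqrt (2 * β + 4) * (Real.sqrt a)⁻¹ ∧
    ProbabilityTheory.variance (fun z : ℝ => z) (cmu β a) ≤
      2 * Real.sqrt (2 * β + 4) * ((Real.sqrt a)⁻¹ * a⁻¹) := by
  have ha0 : 0 < a := by linarith
  have hp := cmu_prob hβ ha0
  have hvn := ProbabilityTheory.variance_nonneg (fun z : ℝ => z) (cmu β a)
  have hv := ProbabilityTheory.variance_eq_sub (cmu_memLp hβ ha0)
  rw [hv] at hvn ⊢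
  simp only [Pi.pow_apply] at hvn ⊢
  set m := ∫ z, z ∂(cmu β a) with hm
  set q := ∫ z, z ^ 2 ∂(cmu β a) with hq
  have hm' : m = (∫ z in Set.Ioi 0, z * cwt β a z) / ∫ z in Set.Ioi 0, cwt β a z :=
    cmu_integral hβ ha0 (fun z => z)
  have hq' : q = (∫ z in Set.Ioi 0, z ^ 2 * cwt β a z) / ∫ z in Set.Ioi 0, cwt β a z :=
    cmu_integral hβ ha0 (fun z => z ^ 2)
  have e2 := cwt_id2 hβ ha0
  have e1 := cwt_id1 hβ ha0
  have hZ := cwt_Z_pos hβ ha0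
  have i0 := cwt_int 0 hβ ha0
  have i1 := cwt_int 1 hβ ha0
  simp only [pow_zero, one_mul, pow_one] at i0 i1
  have id := cwt_div_int hβ ha0
  set Z := ∫ z in Set.Ioi 0, cwt β a z
  set A := ∫ z in Set.Ioi 0, z * cwt β a z
  set B := ∫ z in Set.Ioi 0, z ^ 2 * cwt β a z
  set D := ∫ z in Set.Ioi 0, cwt β a z / z with hD
  have hD0 : 0 ≤ D := setIntegral_nonneg measurableSet_Ioi
    fun z hz => div_nonneg (cwt_pos _ _ _).le (le_of_lt hz)
  have hA : A = m * Z := by rw [hm']; field_simp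
  have hB : B = q * Z := by rw [hq']; field_simp
  rw [hA, hB] at e2
  rw [hA] at e1
  have e2' : a * q = β + 2 * m := by
    have : (a * q - (β + 2 * m)) * Z = 0 := by linarith
    rcases mul_eq_zero.1 this with h | h
    · linarith
    · exact absurd h hZ.ne'
  have hmpos : 0 < m := by
    have : 0 < a * (m * Z) := by rw [e1]; positivity
    have := (mul_pos_iff_of_pos_left ha0).1 this
    exact (mul_pos_iff_of_pos_right hZ).1 this
  have hJ : Z / m ≤ D := by
    have : ∫ z in Set.Ioi 0, (2 / m * cwt β a z - 1 / m ^ 2 * (z * cwt β a z)) ≤ D := by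
      refine setIntegral_mono_on ((i0.const_mul _).sub (i1.const_mul _)) id measurableSet_Ioi ?_
      intro z hz
      have hz : 0 < z := hz
      have h1 : 2 / m - 1 / m ^ 2 * z ≤ 1 / z := by
        rw [← sub_nonneg]
        have : 1 / z - (2 / m - 1 / m ^ 2 * z) = (z - m) ^ 2 / (z * m ^ 2) := by
          field_simp; ring
        rw [this]; positivity
      have := mul_le_mul_of_nonneg_right h1 (cwt_pos β a z).le
      calc _ = (2 / m - 1 / m ^ 2 * z) * cwt β a z := by ring
        _ ≤ _ := this
        _ = _ := by ring
    rw [integral_sub (i0.const_mul _) (i1.const_mul _), integral_const_mul, integral_const_mul] at this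
    change 2 / m * Z - 1 / m ^ 2 * A ≤ D at this
    rw [hA] at this
    calc Z / m = 2 / m * Z - 1 / m ^ 2 * (m * Z) := by field_simp; ring
      _ ≤ D := this
  have hm2 : β ≤ a * m ^ 2 := by
    rw [div_le_iff₀ hmpos] at hJ
    have h1 : a * m ^ 2 * Z = Z * m + β * (D * m) := by
      calc _ = (a * (m * Z)) * m := by ring
        _ = _ := by rw [e1]; ring
    have h2 : β * Z ≤ a * m ^ 2 * Z := by
      rw [h1]; nlinarith [mul_pos hZ hmpos]
    exact le_of_mul_le_mul_right h2 hZ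
  have hmub : a * m ^ 2 ≤ 2 * β + 4 := by
    have h1 : a * m ^ 2 ≤ β + 2 * m := by nlinarith
    have h2 : 2 * m ≤ a * m ^ 2 / 2 + 2 := by nlinarith [sq_nonneg (m - 2)]
    linarith
  have hs : 0 < Real.sqrt a := Real.sqrt_pos.2 ha0
  have hmle : m ≤ Real.sqrt (2 * β + 4) * (Real.sqrt a)⁻¹ := by
    rw [← div_eq_mul_inv, le_div_iff₀ hs]
    apply Real.le_sqrt_of_sq_le
    rw [mul_pow, Real.sq_sqrt ha0.le]
    linarith
  refine ⟨hmpos.le, hmle, ?_⟩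
  have : q - m ^ 2 ≤ 2 * m * a⁻¹ := by
    rw [← div_eq_mul_inv, le_div_iff₀ ha0]
    linarith
  calc q - m ^ 2 ≤ 2 * m * a⁻¹ := this
    _ ≤ 2 * (Real.sqrt (2 * β + 4) * (Real.sqrt a)⁻¹) * a⁻¹ := by gcongr
    _ = _ := by ring

lemma pi_cmu {ι : Type*} [Fintype ι] {β : ℝ} (hβ : 0 < β) (a : ι → ℝ) (ha : ∀ i, 0 < a i) :
    Measure.pi (fun i => cmu β (a i)) =
      (volume : Measure (ι → ℝ)).withDensity (fun y => ENNReal.ofReal (∏ i, cden β (a i) (y i))) := by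
  have hp : ∀ i, IsProbabilityMeasure (cmu β (a i)) := fun i => cmu_prob hβ (ha i)
  refine Measure.pi_eq fun s hs => ?_
  rw [withDensity_apply _ (MeasurableSet.univ_pi hs), volume_pi, Measure.restrict_pi_pi]
  rw [← ofReal_integral_eq_lintegral_ofReal]
  · rw [integral_fintype_prod_eq_prod, ENNReal.ofReal_prod_of_nonneg]
    · refine Finset.prod_congr rfl fun i _ => ?_
      unfold cmu
      rw [withDensity_apply _ (hs i), ← ofReal_integral_eq_lintegral_ofReal]
      · exact (cden_int hβ (ha i)).integrableOn
      · exact ae_of_all _ (cden_nonneg hβ (ha i))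
    · exact fun i _ => integral_nonneg (cden_nonneg hβ (ha i))
  · exact Integrable.fintype_prod fun i => (cden_int hβ (ha i)).integrableOn
  · exact ae_of_all _ fun y => Finset.prod_nonneg fun i _ => cden_nonneg hβ (ha i) _

lemma pi_cmu_integral {ι : Type*} [Fintype ι] {β : ℝ} (hβ : 0 < β) (a : ι → ℝ) (ha : ∀ i, 0 < a i)
    (g : (ι → ℝ) → ℝ) :
    ∫ y, g y ∂(Measure.pi (fun i => cmu β (a i))) = ∫ y, (∏ i, cden β (a i) (y i)) * g y := by
  have hm : Measurable (fun y : ι → ℝ => ∏ i, cden β (a i) (y i)) :=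
    Finset.measurable_prod _ fun i _ => (cden_meas β (a i)).comp (measurable_pi_apply i)
  rw [pi_cmu hβ a ha, integral_withDensity_eq_integral_toReal_smul hm.ennreal_ofReal (by simp)]
  congr 1
  ext y
  rw [ENNReal.toReal_ofReal (Finset.prod_nonneg fun i _ => cden_nonneg hβ (ha i) _), smul_eq_mul]

/-- linear part of the reflection -/
def cL (n : ℕ) : (Fin (n + 1) → ℝ) →ₗ[ℝ] (Fin (n + 1) → ℝ) where
  toFun x := Function.update x 0 (-∑ i, x i)
  map_add' x y := by
    ext i
    refine Fin.cases ?_ (fun j => ?_) i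
    · simp [Finset.sum_add_distrib]; ring
    · simp
  map_smul' c x := by
    ext i
    refine Fin.cases ?_ (fun j => ?_) i
    · simp [Finset.mul_sum]
    · simp

lemma cL_inv (n : ℕ) : cL n ∘ₗ cL n = LinearMap.id := by
  refine LinearMap.ext fun y => ?_
  ext i
  refine Fin.cases ?_ (fun j => ?_) i
  · simp [cL, Fin.sum_univ_succ]
  · simp [cL]

def cT (n : ℕ) (x : Fin (n + 1) → ℝ) : Fin (n + 1) → ℝ := Function.update x 0 (1 - ∑ i, x i)

lemma cT_zero (n : ℕ) (x : Fin (n + 1) → ℝ) : cT n x 0 = 1 - ∑ i, x i := by simp [cT]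
lemma cT_succ (n : ℕ) (x : Fin (n + 1) → ℝ) (i : Fin n) : cT n x i.succ = x i.succ := by simp [cT]

lemma cT_sum (n : ℕ) (x : Fin (n + 1) → ℝ) : ∑ i, cT n x i = 1 - x 0 := by
  rw [Fin.sum_univ_succ, cT_zero, Fin.sum_univ_succ]
  simp only [cT_succ]
  ring

lemma cT_inv (n : ℕ) (x : Fin (n + 1) → ℝ) : cT n (cT n x) = x := by
  ext i
  refine Fin.cases ?_ (fun j => ?_) i
  · rw [cT_zero, cT_sum]; ring
  · rw [cT_succ, cT_succ]

lemma cT_meas (n : ℕ) : Measurable (cT n) := by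
  rw [measurable_pi_iff]
  intro i
  refine Fin.cases ?_ (fun j => ?_) i
  · simp only [cT_zero]; fun_prop
  · simp only [cT_succ]; fun_prop

lemma cL_mp (n : ℕ) : MeasurePreserving (cL n) volume volume := by
  have hd : LinearMap.det (cL n) * LinearMap.det (cL n) = 1 := by
    rw [← LinearMap.det_comp, cL_inv, LinearMap.det_id]
  have hne : LinearMap.det (cL n) ≠ 0 := by
    intro h; rw [h] at hd; norm_num at hd
  refine ⟨(LinearMap.continuous_of_finiteDimensional (cL n)).measurable, ?_⟩
  rw [Real.map_linearMap_volume_pi_eq_smul_volume_pi hne]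
  rcases mul_self_eq_one_iff.1 hd with h | h <;> simp [h]

lemma cT_mp (n : ℕ) : MeasurePreserving (cT n) volume volume := by
  have h := (measurePreserving_add_right (volume : Measure (Fin (n + 1) → ℝ))
    (Pi.single 0 1)).comp (cL_mp n)
  convert! h using 1
  ext x i
  refine Fin.cases ?_ (fun j => ?_) i
  · simp [cT, cL]; ring
  · simp [cT, cL]

def cTe (n : ℕ) : (Fin (n + 1) → ℝ) ≃ᵐ (Fin (n + 1) → ℝ) where
  toFun := cT n
  invFun := cT n
  left_inv := cT_inv n
  right_inv := cT_inv n
  measurable_toFun := cT_meas n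
  measurable_invFun := cT_meas n

def cc (n : ℕ) : Fin (n + 1) → ℕ := Fin.cons (n + 1) (fun i : Fin n => (i : ℕ) + 1)

lemma cc_pos (n : ℕ) (i : Fin (n + 1)) : 1 ≤ cc n i := by
  refine Fin.cases ?_ (fun j => ?_) i <;> simp [cc]

lemma cc_sum (n : ℕ) (f : ℕ → ℝ) : ∑ i, f (cc n i) = ∑ j ∈ Finset.range (n + 1), f (j + 1) := by
  rw [Fin.sum_univ_succ, Finset.sum_range_succ, ← Fin.sum_univ_eq_sum_range (fun j => f (j + 1))]
  simp [cc, add_comm]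

lemma energy_eq (β F : ℝ) (n : ℕ) (y : Fin (n + 1) → ℝ) :
    ∑ k ∈ Finset.Icc 1 (n + 2), (β / coulombCoord (n + 2) k (cT n y)
      + F * (k : ℝ) * coulombCoord (n + 2) k (cT n y)) =
    β / (1 - ∑ i, y i) + F + ∑ i, (β / y i + F * (cc n i : ℝ) * y i) := by
  have h1 : ∀ f : ℕ → ℝ, ∑ k ∈ Finset.Icc 1 (n + 2), f k
      = f 1 + ∑ i : Fin n, f ((i : ℕ) + 2) + f (n + 2) := by
    intro f
    rw [← Finset.Ico_add_one_right_eq_Icc, Finset.sum_Ico_eq_sum_range]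
    have : n + 2 + 1 - 1 = (n + 1) + 1 := by omega
    rw [this, Finset.sum_range_succ, Finset.sum_range_succ', 
      ← Fin.sum_univ_eq_sum_range (fun j => f (1 + (j + 1)))]
    have e : ∀ j : ℕ, 1 + (j + 1) = j + 2 := fun j => by omega
    simp only [e]
    ring
  rw [h1]
  have c1 : coulombCoord (n + 2) 1 (cT n y) = 1 - ∑ i, y i := by
    have : (1:ℕ) - 1 < n + 2 - 1 := by omega
    rw [coulombCoord, dif_pos this]
    exact cT_zero n y
  have c2 : ∀ i : Fin n, coulombCoord (n + 2) ((i : ℕ) + 2) (cT n y) = y i.succ := by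
    intro i
    have : (i : ℕ) + 2 - 1 < n + 2 - 1 := by omega
    rw [coulombCoord, dif_pos this]
    exact cT_succ n y i
  have c3 : coulombCoord (n + 2) (n + 2) (cT n y) = y 0 := by
    have : ¬ (n + 2 - 1 < n + 2 - 1) := by omega
    rw [coulombCoord, dif_neg this]
    have := cT_sum n y
    change 1 - ∑ i : Fin (n + 1), cT n y i = y 0
    rw [this]; ring
  rw [c1, c3]
  simp only [c2]
  have h2 : F * (1 - ∑ i, y i) + ∑ i, (F * (cc n i + 1 : ℝ) * y i) = F + ∑ i, F * (cc n i : ℝ) * y i := by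
    have : ∀ i, F * (cc n i + 1 : ℝ) * y i = F * (cc n i : ℝ) * y i + F * y i := fun i => by ring
    simp only [this, Finset.sum_add_distrib, ← Finset.mul_sum]
    ring
  have h4 : ∑ i, (β / y i + F * (cc n i : ℝ) * y i)
      = ∑ i, β / y i + ∑ i, F * (cc n i : ℝ) * y i := Finset.sum_add_distrib
  rw [h4, add_assoc (β / _) F, add_left_comm F, ← h2]
  rw [Fin.sum_univ_succ (fun i => β / y i), Fin.sum_univ_succ (fun i => F * (cc n i + 1 : ℝ) * y i)]
  simp only [cc, Fin.cons_zero, Fin.cons_succ, Finset.sum_add_distrib]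
  push_cast
  have h3 : ∀ i : Fin n, F * ((i : ℝ) + 2) * y i.succ = F * ((i : ℝ) + 1 + 1) * y i.succ :=
    fun i => by ring
  simp only [h3]
  ring

def cW (β s : ℝ) : ℝ := if s < 1 then Real.exp (-(β / (1 - s))) else 0

lemma dom_iff (n : ℕ) (y : Fin (n + 1) → ℝ) :
    cT n y ∈ coulombDomain (n + 2) ↔ (∀ i, 0 < y i) ∧ ∑ i, y i < 1 := by
  change ((∀ i : Fin (n + 1), 0 < cT n y i ∧ cT n y i < 1) ∧ ∑ i : Fin (n + 1), cT n y i < 1) ↔ _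
  rw [cT_sum, Fin.forall_fin_succ, cT_zero]
  simp only [cT_succ]
  constructor
  · rintro ⟨⟨⟨h1, h2⟩, h3⟩, h4⟩
    refine ⟨?_, by linarith⟩
    rw [Fin.forall_fin_succ]
    exact ⟨by linarith, fun i => (h3 i).1⟩
  · rintro ⟨h1, h2⟩
    have hs : 0 < ∑ i, y i := Finset.sum_pos (fun i _ => h1 i) Finset.univ_nonempty
    refine ⟨⟨⟨by linarith, by linarith⟩, fun i => ⟨h1 _, ?_⟩⟩, by linarith [h1 0]⟩
    have := Finset.single_le_sum (fun j _ => (h1 j).le) (Finset.mem_univ i.succ)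
    linarith

lemma coulomb_eq {β F : ℝ} (hβ : 0 < β) (hF : 0 < F) (n : ℕ) : ∃ K > 0,
    ∀ g : (Fin (n + 2 - 1) → ℝ) → ℝ, coulombInt β F (n + 2) g =
    K * ∫ y, cW β (∑ i, y i) * g (cT n y) ∂(Measure.pi (fun i => cmu β (F * cc n i))) := by
  have ha : ∀ i, 0 < F * (cc n i : ℝ) := fun i => by
    have : (1:ℝ) ≤ cc n i := by exact_mod_cast cc_pos n i
    positivity
  refine ⟨Real.exp (-F) * ∏ i, ∫ z in Set.Ioi 0, cwt β (F * cc n i) z,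
    mul_pos (Real.exp_pos _) (Finset.prod_pos fun i _ => cwt_Z_pos hβ (ha i)), fun g => ?_⟩
  rw [pi_cmu_integral hβ _ ha, ← integral_const_mul]
  have hmeas : MeasurableSet (coulombDomain (n + 2)) := by
    have : coulombDomain (n + 2) = (⋂ i, {x : Fin (n + 2 - 1) → ℝ | 0 < x i ∧ x i < 1}) ∩ {x | ∑ i, x i < 1} := by
      ext x; simp [coulombDomain]
    rw [this]
    refine MeasurableSet.inter (MeasurableSet.iInter fun i => ?_) ?_
    · exact (measurableSet_lt measurable_const (measurable_pi_apply i)).inter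
        (measurableSet_lt (measurable_pi_apply i) measurable_const)
    · exact measurableSet_lt (by fun_prop) measurable_const
  unfold coulombInt
  rw [← integral_indicator hmeas]
  have hmp : MeasurePreserving (cTe n) volume volume := cT_mp n
  refine (hmp.integral_comp' _).symm.trans ?_
  congr 1
  ext y
  change Set.indicator _ _ (cT n y) = _
  by_cases hy : cT n y ∈ coulombDomain (n + 2)
  · rw [Set.indicator_of_mem hy]
    obtain ⟨h1, h2⟩ := (dom_iff n y).1 hy
    rw [energy_eq]
    have hc : ∀ i, cden β (F * cc n i) (y i) = cwt β (F * cc n i) (y i) /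
        ∫ z in Set.Ioi 0, cwt β (F * cc n i) z := fun i => by
      unfold cden; rw [Set.indicator_of_mem (show y i ∈ Set.Ioi (0:ℝ) from h1 i)]
    simp only [hc, Finset.prod_div_distrib]
    have hZ : ∏ i, ∫ z in Set.Ioi 0, cwt β (F * cc n i) z ≠ 0 :=
      (Finset.prod_pos fun i _ => cwt_Z_pos hβ (ha i)).ne'
    have he : ∏ i, cwt β (F * cc n i) (y i) = Real.exp (-∑ i, (β / y i + F * cc n i * y i)) := by
      unfold cwt; rw [← Real.exp_sum, Finset.sum_neg_distrib]
    rw [he, cW, if_pos h2, neg_add, neg_add, Real.exp_add, Real.exp_add]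
    field_simp
  · rw [Set.indicator_of_notMem hy]
    rw [dom_iff, not_and_or] at hy
    rcases hy with h | h
    · push Not at h
      obtain ⟨i, hi⟩ := h
      have : ∏ i, cden β (F * cc n i) (y i) = 0 := by
        refine Finset.prod_eq_zero (Finset.mem_univ i) ?_
        unfold cden
        rw [Set.indicator_of_notMem]
        simpa using hi
      rw [this]; ring
    · rw [cW, if_neg h]; ring

lemma cW_nonneg (β s : ℝ) : 0 ≤ cW β s := by
  unfold cW; split_ifs
  · exact (Real.exp_pos _).le
  · exact le_rfl

lemma cW_le {β : ℝ} (hβ : 0 < β) (s : ℝ) : cW β s ≤ 1 := by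
  unfold cW; split_ifs with h
  · rw [Real.exp_le_one_iff]
    have : 0 < β / (1 - s) := div_pos hβ (by linarith)
    linarith
  · norm_num

lemma cW_ge {β : ℝ} (hβ : 0 < β) {s : ℝ} (hs : 0 ≤ s) :
    Real.exp (-(2 * β)) * (1 - 2 * s) ≤ cW β s := by
  by_cases h : s < 1 / 2
  · unfold cW
    rw [if_pos (by linarith)]
    have h1 : Real.exp (-(2 * β)) ≤ Real.exp (-(β / (1 - s))) := by
      apply Real.exp_le_exp.2
      have : β / (1 - s) ≤ 2 * β := by
        rw [div_le_iff₀ (by linarith)]; nlinarith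
      linarith
    nlinarith [Real.exp_pos (-(2 * β))]
  · have := cW_nonneg β s
    nlinarith [Real.exp_pos (-(2 * β))]

lemma cW_meas (β : ℝ) : Measurable (cW β) := by
  unfold cW
  exact Measurable.ite measurableSet_Iio (by fun_prop) measurable_const

lemma abstract_var {Ω : Type*} [MeasurableSpace Ω] (P : Measure Ω) [IsProbabilityMeasure P]
    {β : ℝ} (hβ : 0 < β) (S : Ω → ℝ) (hSm : Measurable S) (hS : MemLp S 2 P)
    (hS0 : ∀ᵐ y ∂P, 0 ≤ S y) (hE : ∫ y, S y ∂P ≤ 1 / 4) :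
    0 < ∫ y, cW β (S y) ∂P ∧
    0 ≤ (∫ y, cW β (S y) * (1 - S y) ^ 2 ∂P) / (∫ y, cW β (S y) ∂P)
      - ((∫ y, cW β (S y) * (1 - S y) ∂P) / (∫ y, cW β (S y) ∂P)) ^ 2 ∧
    (∫ y, cW β (S y) * (1 - S y) ^ 2 ∂P) / (∫ y, cW β (S y) ∂P)
      - ((∫ y, cW β (S y) * (1 - S y) ∂P) / (∫ y, cW β (S y) ∂P)) ^ 2
      ≤ 2 * Real.exp (2 * β) * ProbabilityTheory.variance S P := by
  have hSi : Integrable S P := hS.integrable (by norm_num)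
  have hWm : Measurable fun y => cW β (S y) := (cW_meas β).comp hSm
  have hb : ∀ g : Ω → ℝ, Integrable g P → Integrable (fun y => cW β (S y) * g y) P := by
    intro g hg
    refine hg.bdd_mul (c := 1) hWm.aestronglyMeasurable (ae_of_all _ fun y => ?_)
    rw [Real.norm_of_nonneg (cW_nonneg _ _)]
    exact cW_le hβ _
  have hX : MemLp (fun y => 1 - S y) 2 P := (memLp_const 1).sub hS
  have hX1 : Integrable (fun y => 1 - S y) P := hX.integrable (by norm_num)
  have hX2 : Integrable (fun y => (1 - S y) ^ 2) P := hX.integrable_sq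
  have iA : Integrable (fun y => cW β (S y)) P := by
    have := hb (fun _ => 1) (integrable_const 1)
    simpa using this
  have iB := hb _ hX1
  have iD := hb _ hX2
  set A := ∫ y, cW β (S y) ∂P with hA
  set B := ∫ y, cW β (S y) * (1 - S y) ∂P with hB
  set D := ∫ y, cW β (S y) * (1 - S y) ^ 2 ∂P with hD
  have hAge : Real.exp (-(2 * β)) / 2 ≤ A := by
    have h1 : ∫ y, Real.exp (-(2 * β)) * (1 - 2 * S y) ∂P ≤ A := by
      refine integral_mono_ae (((integrable_const 1).sub (hSi.const_mul 2)).const_mul _) iA ?_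
      filter_upwards [hS0] with y hy using cW_ge hβ hy
    rw [integral_const_mul, integral_sub (integrable_const 1) (hSi.const_mul 2),
      integral_const_mul] at h1
    simp only [integral_const, probReal_univ, smul_eq_mul, mul_one] at h1
    nlinarith [Real.exp_pos (-(2 * β))]
  have hApos : 0 < A := lt_of_lt_of_le (by positivity) hAge
  have key : ∀ c : ℝ, ∫ y, cW β (S y) * ((1 - S y) - c) ^ 2 ∂P = D - 2 * c * B + c ^ 2 * A := by
    intro c
    have i1 : Integrable (fun y => cW β (S y) * (1 - S y) ^ 2
        - 2 * c * (cW β (S y) * (1 - S y))) P := iD.sub (iB.const_mul (2 * c))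
    have e : (fun y => cW β (S y) * ((1 - S y) - c) ^ 2) = fun y =>
        (cW β (S y) * (1 - S y) ^ 2 - 2 * c * (cW β (S y) * (1 - S y))) + c ^ 2 * cW β (S y) := by
      ext y; ring
    rw [e, integral_add i1 (iA.const_mul _), integral_sub iD (iB.const_mul (2 * c)),
      integral_const_mul, integral_const_mul]
  refine ⟨hApos, ?_, ?_⟩
  · have h := key (B / A)
    have h0 : 0 ≤ ∫ y, cW β (S y) * ((1 - S y) - B / A) ^ 2 ∂P :=
      integral_nonneg fun y => mul_nonneg (cW_nonneg _ _) (sq_nonneg _)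
    rw [h] at h0
    have : D / A - (B / A) ^ 2 = (D - 2 * (B / A) * B + (B / A) ^ 2 * A) / A := by
      field_simp; ring
    rw [this]; positivity
  · set m := ∫ y, S y ∂P with hm
    have h := key (1 - m)
    have hvar : ProbabilityTheory.variance S P = ∫ y, (S y - m) ^ 2 ∂P :=
      ProbabilityTheory.variance_eq_integral hSm.aemeasurable
    have iV : Integrable (fun y => (S y - m) ^ 2) P := (hS.sub (memLp_const m)).integrable_sq
    have hle : ∫ y, cW β (S y) * ((1 - S y) - (1 - m)) ^ 2 ∂P ≤ ProbabilityTheory.variance S P := by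
      rw [hvar]
      have e : (fun y => cW β (S y) * ((1 - S y) - (1 - m)) ^ 2)
          = fun y => cW β (S y) * (S y - m) ^ 2 := by ext y; ring
      rw [e]
      refine integral_mono (hb _ iV) iV fun y => ?_
      have := mul_le_mul_of_nonneg_right (cW_le hβ (S y)) (sq_nonneg (S y - m))
      simpa using this
    rw [h] at hle
    have hv0 := ProbabilityTheory.variance_nonneg S P
    have h1 : D / A - (B / A) ^ 2 ≤ (D - 2 * (1 - m) * B + (1 - m) ^ 2 * A) / A := by
      have : (D - 2 * (1 - m) * B + (1 - m) ^ 2 * A) / A - (D / A - (B / A) ^ 2)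
          = (B / A - (1 - m)) ^ 2 := by field_simp; ring
      nlinarith [sq_nonneg (B / A - (1 - m))]
    refine h1.trans ?_
    rw [div_le_iff₀ hApos]
    refine hle.trans ?_
    have h2 : 1 ≤ 2 * Real.exp (2 * β) * A := by
      have : Real.exp (2 * β) * Real.exp (-(2 * β)) = 1 := by rw [← Real.exp_add]; simp
      nlinarith [Real.exp_pos (2 * β)]
    nlinarith

lemma cmu_ae_pos (β a : ℝ) : ∀ᵐ z ∂(cmu β a), 0 < z := by
  unfold cmu
  rw [ae_withDensity_iff (cden_meas β a).ennreal_ofReal]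
  refine ae_of_all _ fun z hz => ?_
  by_contra h
  apply hz
  unfold cden
  rw [Set.indicator_of_notMem (by simpa using h)]
  simp

lemma sum_inv_sqrt (n : ℕ) :
    ∑ j ∈ Finset.range n, (Real.sqrt ((j + 1 : ℕ) : ℝ))⁻¹ ≤ 2 * Real.sqrt n := by
  induction n with
  | zero => simp
  | succ n ih =>
    rw [Finset.sum_range_succ]
    have h1 : 0 < Real.sqrt ((n + 1 : ℕ) : ℝ) := Real.sqrt_pos.2 (by positivity)
    have h2 : (Real.sqrt ((n + 1 : ℕ) : ℝ)) ^ 2 = n + 1 := by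
      rw [Real.sq_sqrt (by positivity)]; push_cast; ring
    have h3 : (Real.sqrt (n : ℝ)) ^ 2 = n := Real.sq_sqrt (by positivity)
    have h0 : 0 ≤ Real.sqrt (n : ℝ) := Real.sqrt_nonneg _
    have h4 : (Real.sqrt ((n + 1 : ℕ) : ℝ))⁻¹
        ≤ 2 * Real.sqrt ((n + 1 : ℕ) : ℝ) - 2 * Real.sqrt n := by
      rw [inv_le_iff_one_le_mul₀ h1]
      nlinarith [sq_nonneg (Real.sqrt ((n + 1 : ℕ) : ℝ) - Real.sqrt n)]
    linarith

lemma sum_inv_32 : ∃ C > (0:ℝ), ∀ n : ℕ,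
    ∑ j ∈ Finset.range n, (Real.sqrt ((j + 1 : ℕ) : ℝ))⁻¹ * (((j + 1 : ℕ) : ℝ))⁻¹ ≤ C := by
  have hs : Summable (fun j : ℕ => (Real.sqrt ((j : ℕ) : ℝ))⁻¹ * ((j : ℕ) : ℝ)⁻¹) := by
    have h := Real.summable_nat_rpow_inv.2 (show (1:ℝ) < 3 / 2 by norm_num)
    refine h.congr fun j => ?_
    rw [← mul_inv, Real.sqrt_eq_rpow]
    congr 1
    rcases Nat.eq_zero_or_pos j with h | h
    · subst h; norm_num
    · have hj : (0:ℝ) < j := by exact_mod_cast h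
      rw [← Real.rpow_add_one hj.ne']; norm_num
  have hs1 := (summable_nat_add_iff 1).2 hs
  refine ⟨(∑' j : ℕ, (Real.sqrt ((j + 1 : ℕ) : ℝ))⁻¹ * (((j + 1 : ℕ) : ℝ))⁻¹) + 1, ?_, fun n => ?_⟩
  · have : 0 ≤ ∑' j : ℕ, (Real.sqrt ((j + 1 : ℕ) : ℝ))⁻¹ * (((j + 1 : ℕ) : ℝ))⁻¹ :=
      tsum_nonneg fun j => by positivity
    linarith
  · have := hs1.sum_le_tsum (Finset.range n) (fun j _ => by positivity)
    linarith

/-- Strong supercritical force `F ≫ N`: the variance of the first spacing is `O(F^{−3/2})`. -/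
theorem var_first_spacing_strong_supercritical (β : ℝ) (hβ : 0 < β)
    (F : ℕ → ℝ) (hF0 : ∀ N, 0 < F N)
    (hF : Tendsto (fun N : ℕ => F N / N) atTop atTop) :
    ∃ C > (0:ℝ), ∃ N₀ : ℕ, ∀ N ≥ N₀,
      0 ≤ condVar β N (F N) 1 ∧
      condVar β N (F N) 1 ≤ C * (F N) ^ (-(3:ℝ)/2) := by
  obtain ⟨C₀, hC₀, hsum⟩ := sum_inv_32
  set K := Real.sqrt (2 * β + 4) with hK
  have hKpos : 0 < K := Real.sqrt_pos.2 (by linarith)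
  have hK2 : K ^ 2 = 2 * β + 4 := Real.sq_sqrt (by linarith)
  obtain ⟨N₁, hN₁⟩ := eventually_atTop.1 (hF.eventually_ge_atTop (64 * K ^ 2))
  refine ⟨2 * Real.exp (2 * β) * (2 * K * C₀), by positivity, max N₁ 2, fun N hN => ?_⟩
  have hFN := hN₁ N (le_trans (le_max_left _ _) hN)
  obtain ⟨n, rfl⟩ := Nat.exists_eq_add_of_le' (le_trans (le_max_right _ _) hN)
  have hf0 := hF0 (n + 2)
  generalize F (n + 2) = f at hFN hf0
  have hn0 : (0:ℝ) ≤ n := Nat.cast_nonneg n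
  rw [le_div_iff₀ (by positivity)] at hFN
  push_cast at hFN
  have hf1 : 1 ≤ f := by nlinarith
  have ha : ∀ i, 1 ≤ f * (cc n i : ℝ) := fun i => by
    have : (1:ℝ) ≤ cc n i := by exact_mod_cast cc_pos n i
    nlinarith
  have hp : ∀ i, IsProbabilityMeasure (cmu β (f * cc n i)) :=
    fun i => cmu_prob hβ (lt_of_lt_of_le one_pos (ha i))
  have hL : ∀ i, MemLp (fun z : ℝ => z) 2 (cmu β (f * cc n i)) :=
    fun i => cmu_memLp hβ (lt_of_lt_of_le one_pos (ha i))
  set P := Measure.pi (fun i => cmu β (f * cc n i)) with hP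
  have hLi : ∀ i, MemLp (fun y : Fin (n + 1) → ℝ => y i) 2 P := fun i =>
    (hL i).comp_measurePreserving (measurePreserving_eval _ i)
  have hS : MemLp (fun y : Fin (n + 1) → ℝ => ∑ i, y i) 2 P := memLp_finset_sum _ fun i _ => hLi i
  have hsf : 0 < Real.sqrt f := Real.sqrt_pos.2 hf0
  have hmean : ∫ y, (∑ i, y i) ∂P ≤ 1 / 4 := by
    rw [integral_finset_sum _ fun i _ => (hLi i).integrable (by norm_num)]
    have h1 : ∀ i, ∫ y, y i ∂P ≤ K * ((Real.sqrt f)⁻¹ * (Real.sqrt (cc n i))⁻¹) := by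
      intro i
      have := integral_eval (μ := fun i => cmu β (f * cc n i)) (i := i)
      rw [hP, this]
      refine (cmu_main hβ (ha i)).2.1.trans (le_of_eq ?_)
      rw [Real.sqrt_mul hf0.le, mul_inv]
    refine (Finset.sum_le_sum fun i _ => h1 i).trans ?_
    rw [← Finset.mul_sum, ← Finset.mul_sum, cc_sum n (fun j => (Real.sqrt (j : ℝ))⁻¹)]
    have h2 := sum_inv_sqrt (n + 1)
    have h3 : 8 * K * Real.sqrt ((n + 1 : ℕ) : ℝ) ≤ Real.sqrt f := by
      apply Real.le_sqrt_of_sq_le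
      rw [mul_pow, Real.sq_sqrt (by positivity)]
      push_cast
      nlinarith [sq_nonneg K]
    calc _ ≤ K * ((Real.sqrt f)⁻¹ * (2 * Real.sqrt ((n + 1 : ℕ) : ℝ))) := by gcongr
      _ = (2 * K * Real.sqrt ((n + 1 : ℕ) : ℝ)) / Real.sqrt f := by ring
      _ ≤ 1 / 4 := by rw [div_le_iff₀ hsf]; linarith
  have hvar : ProbabilityTheory.variance (fun y : Fin (n + 1) → ℝ => ∑ i, y i) P
      ≤ 2 * K * C₀ * f ^ (-(3:ℝ)/2) := by
    have h0 := ProbabilityTheory.variance_sum_pi hL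
    have e : (fun y : Fin (n + 1) → ℝ => ∑ i, y i) = ∑ i, fun y : Fin (n + 1) → ℝ => y i := by
      ext y; simp
    rw [e, hP, h0]
    have hpow : f ^ (-(3:ℝ)/2) = (Real.sqrt f)⁻¹ * f⁻¹ := by
      rw [← mul_inv, Real.sqrt_eq_rpow, ← Real.rpow_add_one hf0.ne', ← Real.rpow_neg hf0.le]
      norm_num
    have h1 : ∀ i, ProbabilityTheory.variance (fun z : ℝ => z) (cmu β (f * cc n i)) ≤
        2 * K * ((Real.sqrt f)⁻¹ * f⁻¹) * ((Real.sqrt (cc n i))⁻¹ * (cc n i : ℝ)⁻¹) := by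
      intro i
      refine (cmu_main hβ (ha i)).2.2.trans (le_of_eq ?_)
      rw [Real.sqrt_mul hf0.le, mul_inv, mul_inv]
      ring
    refine (Finset.sum_le_sum fun i _ => h1 i).trans ?_
    rw [← Finset.mul_sum, cc_sum n (fun j => (Real.sqrt (j : ℝ))⁻¹ * (j : ℝ)⁻¹), hpow]
    calc _ ≤ 2 * K * ((Real.sqrt f)⁻¹ * f⁻¹) * C₀ := by
          have := hsum (n + 1)
          gcongr
      _ = _ := by ring
  have hpos : ∀ᵐ y ∂P, 0 ≤ ∑ i, y i := by
    have : ∀ᵐ y ∂P, ∀ i, 0 < y i := by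
      rw [ae_all_iff]
      intro i
      exact Measure.tendsto_eval_ae_ae.eventually (cmu_ae_pos β (f * cc n i))
    filter_upwards [this] with y hy using Finset.sum_nonneg fun i _ => (hy i).le
  obtain ⟨hApos, hlow, hup⟩ := abstract_var P hβ (fun y : Fin (n + 1) → ℝ => ∑ i, y i)
    (by fun_prop) hS hpos hmean
  obtain ⟨M, hM, hI⟩ := coulomb_eq hβ hf0 n
  have c1 : ∀ y, coulombCoord (n + 2) 1 (cT n y) = 1 - ∑ i, y i := by
    intro y
    have : (1:ℕ) - 1 < n + 2 - 1 := by omega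
    rw [coulombCoord, dif_pos this]
    exact cT_zero n y
  have hcv : condVar β (n + 2) f 1 = (∫ y, cW β (∑ i, y i) * (1 - ∑ i, y i) ^ 2 ∂P) / (∫ y, cW β (∑ i, y i) ∂P)
      - ((∫ y, cW β (∑ i, y i) * (1 - ∑ i, y i) ∂P) / (∫ y, cW β (∑ i, y i) ∂P)) ^ 2 := by
    unfold condVar condMean
    rw [hI, hI, hI]
    simp only [c1, mul_one]
    rw [mul_div_mul_left _ _ hM.ne', mul_div_mul_left _ _ hM.ne']
  rw [hcv]
  refine ⟨hlow, hup.trans ?_⟩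
  calc _ ≤ 2 * Real.exp (2 * β) * (2 * K * C₀ * f ^ (-(3:ℝ)/2)) := by gcongr
    _ = _ := by ring
end
end

section
/- Fix β > 0 and let F : ℕ → [0,∞) satisfy F(N)/N → 0 as N → ∞. For each N ≥ 2 let λ(N) be the unique real number with Σ_{k=1}^N m(λ(N) + k·F(N)) = 1. Then there exist a constant C > 0 and N₀ ∈ ℕ such that for all N ≥ N₀, | λ(N) / ( β·N²·(1 − F(N)/(4βN))² ) − 1 | ≤ C/N; that is, λ(N) = β·(1 − F(N)/(4βN))²·N²·(1 + O(1/N)). -/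
open MeasureTheory Filter

noncomputable section

/-- Normalizing constant `c(λ) = ∫₀¹ e^{−λx − β/x} dx`. -/
def cpart (β l : ℝ) : ℝ := ∫ x in (0:ℝ)..1, Real.exp (-(l * x) - β / x)

/-- Single-particle mean `m(λ)`. -/
def mpart (β l : ℝ) : ℝ :=
  (∫ x in (0:ℝ)..1, x * Real.exp (-(l * x) - β / x)) / cpart β l

/-- Single-particle variance `v(λ)`. -/
def vpart (β l : ℝ) : ℝ :=
  (∫ x in (0:ℝ)..1, x ^ 2 * Real.exp (-(l * x) - β / x)) / cpart β l - mpart β l ^ 2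

def ww (β l x : ℝ) : ℝ := Real.exp (-(l * x) - β / x)

lemma ww_pos (β l x : ℝ) : 0 < ww β l x := Real.exp_pos _

lemma ww_meas (β l : ℝ) : Measurable (ww β l) := by
  unfold ww; fun_prop

lemma ww_le (β l x : ℝ) (hβ : 0 < β) (hx : 0 < x) (hx1 : x ≤ 1) : ww β l x ≤ Real.exp |l| := by
  unfold ww
  apply Real.exp_le_exp.mpr
  have h1 : 0 ≤ β / x := by positivity
  have h2 : -(l * x) ≤ |l| := by
    have := neg_abs_le l
    have h3 := abs_nonneg l
    nlinarith
  linarith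

lemma ww_div_le (β l x : ℝ) (hβ : 0 < β) (hx : 0 < x) (hx1 : x ≤ 1) :
    x⁻¹ * ww β l x ≤ Real.exp |l| / β := by
  have h1 : ww β l x = Real.exp (-(l*x)) * Real.exp (-(β/x)) := by
    unfold ww; rw [← Real.exp_add]; ring_nf
  have h2 : Real.exp (-(l*x)) ≤ Real.exp |l| := by
    apply Real.exp_le_exp.mpr
    have := neg_abs_le l
    have h3 := abs_nonneg l
    nlinarith
  have h3 : Real.exp (-(β/x)) ≤ x / β := by
    rw [Real.exp_neg]
    have : β / x ≤ Real.exp (β/x) := by linarith [Real.add_one_le_exp (β/x)]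
    calc (Real.exp (β/x))⁻¹ ≤ (β/x)⁻¹ := inv_anti₀ (by positivity) this
      _ = x / β := by rw [inv_div]
  rw [h1]
  calc x⁻¹ * (Real.exp (-(l*x)) * Real.exp (-(β/x))) ≤ x⁻¹ * (Real.exp |l| * (x/β)) := by gcongr
    _ = Real.exp |l| / β := by field_simp

lemma int_of_bdd (g : ℝ → ℝ) (hg : Measurable g) (K : ℝ)
    (h : ∀ x, 0 < x → x ≤ 1 → |g x| ≤ K) : IntervalIntegrable g volume 0 1 := by
  rw [intervalIntegrable_iff_integrableOn_Ioc_of_le zero_le_one]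
  apply MeasureTheory.Measure.integrableOn_of_bounded (M := K) (by simp) hg.aestronglyMeasurable
  filter_upwards [ae_restrict_mem measurableSet_Ioc] with x hx
  exact h x hx.1 hx.2

lemma int0 (β l : ℝ) (hβ : 0 < β) : IntervalIntegrable (ww β l) volume 0 1 := by
  apply int_of_bdd _ (ww_meas β l) (Real.exp |l|)
  intro x h0 h1
  rw [abs_of_pos (ww_pos _ _ _)]
  exact ww_le β l x hβ h0 h1

lemma int_mul (β l : ℝ) (hβ : 0 < β) (g : ℝ → ℝ) (hg : Continuous g) :
    IntervalIntegrable (fun x => g x * ww β l x) volume 0 1 :=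
  (int0 β l hβ).continuousOn_mul hg.continuousOn

lemma int1 (β l : ℝ) (hβ : 0 < β) :
    IntervalIntegrable (fun x => x * ww β l x) volume 0 1 :=
  int_mul β l hβ (fun x => x) continuous_id

lemma int2 (β l : ℝ) (hβ : 0 < β) :
    IntervalIntegrable (fun x => x^2 * ww β l x) volume 0 1 :=
  int_mul β l hβ (fun x => x^2) (by fun_prop)

lemma intc (β l a : ℝ) (hβ : 0 < β) :
    IntervalIntegrable (fun x => (x - a) * ww β l x) volume 0 1 :=
  int_mul β l hβ (fun x => x - a) (by fun_prop)

lemma int_inv (β l : ℝ) (hβ : 0 < β) :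
    IntervalIntegrable (fun x => x⁻¹ * ww β l x) volume 0 1 := by
  apply int_of_bdd (fun x => x⁻¹ * ww β l x) (measurable_inv.mul (ww_meas β l)) (Real.exp |l| / β)
  intro x h0 h1
  rw [abs_of_pos (mul_pos (inv_pos.mpr h0) (ww_pos _ _ _))]
  exact ww_div_le β l x hβ h0 h1

lemma cpart_eq (β l : ℝ) : cpart β l = ∫ x in (0:ℝ)..1, ww β l x := rfl

lemma cpart_pos (β l : ℝ) (hβ : 0 < β) : 0 < cpart β l := by
  rw [cpart_eq]
  exact intervalIntegral.intervalIntegral_pos_of_pos (int0 β l hβ) (fun x => ww_pos β l x) one_pos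

lemma m1_eq (β l : ℝ) (hβ : 0 < β) :
    ∫ x in (0:ℝ)..1, x * ww β l x = mpart β l * cpart β l := by
  unfold mpart
  rw [div_mul_cancel₀ _ (cpart_pos β l hβ).ne']
  rfl

lemma mpart_pos (β l : ℝ) (hβ : 0 < β) : 0 < mpart β l := by
  have : 0 < mpart β l * cpart β l := by
    rw [← m1_eq β l hβ]
    apply intervalIntegral.intervalIntegral_pos_of_pos_on (int1 β l hβ)
      (fun x hx => mul_pos hx.1 (ww_pos β l x)) one_pos
  exact pos_of_mul_pos_left this (cpart_pos β l hβ).le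

lemma center (β l a : ℝ) (hβ : 0 < β) :
    ∫ x in (0:ℝ)..1, (x - a) * ww β l x = (mpart β l - a) * cpart β l := by
  have : ∀ x, (x - a) * ww β l x = x * ww β l x - a * ww β l x := fun x => by ring
  simp_rw [this]
  rw [intervalIntegral.integral_sub (int1 β l hβ)
    ((int0 β l hβ).const_mul a), m1_eq β l hβ, intervalIntegral.integral_const_mul, ← cpart_eq]
  ring

lemma mpart_anti (β : ℝ) (hβ : 0 < β) : Antitone (mpart β) := by
  intro l l' hl
  set a := mpart β l' with ha
  have h1 : ∫ x in (0:ℝ)..1, Real.exp ((l' - l) * a) * ((x - a) * ww β l' x)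
      ≤ ∫ x in (0:ℝ)..1, (x - a) * ww β l x := by
    apply intervalIntegral.integral_mono_on zero_le_one
    · exact (intc β l' a hβ).const_mul _
    · exact (intc β l a hβ)
    intro x hx
    have e : ww β l x = Real.exp ((l' - l) * x) * ww β l' x := by
      unfold ww; rw [← Real.exp_add]; ring_nf
    rw [e]
    have hw := ww_pos β l' x
    have : 0 ≤ (x - a) * (Real.exp ((l' - l) * x) - Real.exp ((l' - l) * a)) := by
      rcases le_total x a with h | h
      · apply mul_nonneg_of_nonpos_of_nonpos (by linarith)
        have : Real.exp ((l' - l) * x) ≤ Real.exp ((l' - l) * a) :=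
          Real.exp_le_exp.mpr (by nlinarith)
        linarith
      · apply mul_nonneg (by linarith)
        have : Real.exp ((l' - l) * a) ≤ Real.exp ((l' - l) * x) :=
          Real.exp_le_exp.mpr (by nlinarith)
        linarith
    nlinarith [mul_nonneg this hw.le]
  rw [intervalIntegral.integral_const_mul, center β l' a hβ, center β l a hβ, ← ha] at h1
  have := cpart_pos β l hβ
  by_contra! h
  nlinarith

lemma ww_deriv (β l x : ℝ) (hx : x ≠ 0) :
    HasDerivAt (ww β l) ((-l + β * (x⁻¹)^2) * ww β l x) x := by
  have h1 : HasDerivAt (fun x : ℝ => -(l * x) - β / x) (-l + β * (x⁻¹)^2) x := by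
    have := (((hasDerivAt_id x).const_mul l).neg).sub ((hasDerivAt_inv hx).const_mul β)
    exact this.congr_deriv (by simp)
  have := h1.exp
  unfold ww
  convert this using 1
  ring

lemma xww_cont (β l : ℝ) (hβ : 0 < β) : ContinuousOn (fun x => x * ww β l x) (Set.Icc 0 1) := by
  intro x hx
  rcases eq_or_ne x 0 with h | h
  · subst h
    unfold ContinuousWithinAt
    simp only [zero_mul]
    apply squeeze_zero_norm' (a := fun x => x * Real.exp |l|)
    · filter_upwards [self_mem_nhdsWithin] with y hy
      rw [Real.norm_eq_abs, abs_of_nonneg (mul_nonneg hy.1 (ww_pos _ _ _).le)]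
      rcases eq_or_lt_of_le hy.1 with h | h
      · rw [← h]; simp
      · exact mul_le_mul_of_nonneg_left (ww_le β l y hβ h hy.2) hy.1
    · have : Continuous (fun x : ℝ => x * Real.exp |l|) := by fun_prop
      have := this.tendsto 0
      rw [zero_mul] at this
      exact this.mono_left nhdsWithin_le_nhds
  · exact (continuousAt_id.mul (ww_deriv β l x h).continuousAt).continuousWithinAt

lemma ibp2 (β l : ℝ) (hβ : 0 < β) :
    2 * (mpart β l * cpart β l) - l * (∫ x in (0:ℝ)..1, x^2 * ww β l x) + β * cpart β l
      = ww β l 1 := by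
  have h := intervalIntegral.integral_eq_sub_of_hasDerivAt_of_le (a := 0) (b := 1)
    (f := fun x => x * (x * ww β l x))
    (f' := fun x => 2 * (x * ww β l x) - l * (x^2 * ww β l x) + β * ww β l x) zero_le_one
    (continuousOn_id.mul (xww_cont β l hβ))
    (by
      intro x hx
      have hx0 : x ≠ 0 := hx.1.ne'
      have := (hasDerivAt_id x).mul ((hasDerivAt_id x).mul (ww_deriv β l x hx0))
      exact this.congr_deriv (by simp [-mul_eq_mul_left_iff]; field_simp; ring))
    ((((int1 β l hβ).const_mul 2).sub
      ((int2 β l hβ).const_mul l)).add ((int0 β l hβ).const_mul β))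
  rw [intervalIntegral.integral_add (((int1 β l hβ).const_mul 2).sub
      ((int2 β l hβ).const_mul l)) ((int0 β l hβ).const_mul β),
    intervalIntegral.integral_sub ((int1 β l hβ).const_mul 2)
      ((int2 β l hβ).const_mul l),
    intervalIntegral.integral_const_mul, intervalIntegral.integral_const_mul,
    intervalIntegral.integral_const_mul] at h
  have h2 := m1_eq β l hβ
  have h3 := cpart_eq β l
  simp only [one_mul, zero_mul, sub_zero] at h
  rw [← h, h2, ← h3]

lemma ibp1 (β l : ℝ) (hβ : 0 < β) :
    cpart β l - l * (mpart β l * cpart β l) + β * (∫ x in (0:ℝ)..1, x⁻¹ * ww β l x)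
      = ww β l 1 := by
  have i1 := (int1 β l hβ).const_mul l
  have i2 := (int_inv β l hβ).const_mul β
  have h := intervalIntegral.integral_eq_sub_of_hasDerivAt_of_le (a := 0) (b := 1)
    (f := fun x => (x * ww β l x))
    (f' := fun x => ww β l x - l * (x * ww β l x) + β * (x⁻¹ * ww β l x)) zero_le_one
    (xww_cont β l hβ)
    (by
      intro x hx
      have hx0 : x ≠ 0 := hx.1.ne'
      have := ((hasDerivAt_id x).mul (ww_deriv β l x hx0))
      exact this.congr_deriv (by simp [-mul_eq_mul_left_iff]; field_simp; ring))
    (((int0 β l hβ).sub i1).add i2)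
  rw [intervalIntegral.integral_add ((int0 β l hβ).sub i1) i2,
    intervalIntegral.integral_sub (int0 β l hβ) i1,
    intervalIntegral.integral_const_mul, intervalIntegral.integral_const_mul] at h
  have h2 := m1_eq β l hβ
  have h3 := cpart_eq β l
  simp only [one_mul, zero_mul, sub_zero] at h
  rw [← h, h2, ← h3]

lemma m_upper (β l : ℝ) (hβ : 0 < β) (hl : 0 < l) :
    l * mpart β l ^ 2 ≤ β + 2 * mpart β l := by
  have hc := cpart_pos β l hβ
  have h := ibp2 β l hβ
  have hw := ww_pos β l 1
  set a := mpart β l with ha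
  have i1 := (intc β l a hβ).const_mul (2 * a)
  have i2 := (int0 β l hβ).const_mul (a^2)
  have h1 : ∫ x in (0:ℝ)..1, (2 * a * ((x - a) * ww β l x) + a^2 * ww β l x)
      ≤ ∫ x in (0:ℝ)..1, x^2 * ww β l x := by
    apply intervalIntegral.integral_mono_on zero_le_one (i1.add i2)
      (int2 β l hβ)
    intro x hx
    nlinarith [mul_nonneg (sq_nonneg (x - a)) (ww_pos β l x).le]
  rw [intervalIntegral.integral_add i1 i2, intervalIntegral.integral_const_mul,
    intervalIntegral.integral_const_mul, center β l a hβ, ← cpart_eq, ← ha] at h1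
  have h2 := mul_le_mul_of_nonneg_left h1 hl.le
  have : (l * a^2) * cpart β l ≤ (β + 2 * a) * cpart β l := by linarith
  exact le_of_mul_le_mul_right this hc

lemma ww1_le (β l : ℝ) (hβ : 0 < β) (hl : 2 * β + 4 ≤ l) : ww β l 1 ≤ cpart β l := by
  have hi := int0 β l hβ
  have s1 : Set.uIcc (1/2:ℝ) 1 ⊆ Set.uIcc 0 1 := by
    rw [Set.uIcc_of_le (by norm_num), Set.uIcc_of_le (by norm_num)]
    exact Set.Icc_subset_Icc (by norm_num) le_rfl
  have s0 : Set.uIcc (0:ℝ) (1/2) ⊆ Set.uIcc 0 1 := by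
    rw [Set.uIcc_of_le (by norm_num), Set.uIcc_of_le (by norm_num)]
    exact Set.Icc_subset_Icc le_rfl (by norm_num)
  have hi1 := hi.mono_set s1
  have hi0 := hi.mono_set s0
  have e := intervalIntegral.integral_add_adjacent_intervals hi0 hi1
  rw [cpart_eq, ← e]
  have p : 0 ≤ ∫ x in (0:ℝ)..(1/2), ww β l x :=
    intervalIntegral.integral_nonneg (by norm_num) (fun x _ => (ww_pos β l x).le)
  have q : ∫ x in (1/2:ℝ)..1, ww β l 1 * (5 - 4 * x) ≤ ∫ x in (1/2:ℝ)..1, ww β l x := by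
    apply intervalIntegral.integral_mono_on (by norm_num) _ hi1
    · intro x hx
      have hx0 : 0 < x := by linarith [hx.1]
      have : ww β l x = ww β l 1 * Real.exp (l * (1 - x) - β * (1 - x) / x) := by
        unfold ww; rw [← Real.exp_add]; congr 1; field_simp; ring
      rw [this]
      apply mul_le_mul_of_nonneg_left _ (ww_pos β l 1).le
      have h1 : β * (1 - x) / x ≤ 2 * (β * (1 - x)) := by
        rw [div_le_iff₀ hx0]
        have : 0 ≤ β * (1 - x) := mul_nonneg hβ.le (by linarith [hx.2])
        nlinarith [hx.1]
      have h2 := Real.add_one_le_exp (l * (1 - x) - β * (1 - x) / x)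
      nlinarith [hx.2]
    · apply Continuous.intervalIntegrable; fun_prop
  have r : ∫ x in (1/2:ℝ)..1, ww β l 1 * (5 - 4 * x) = ww β l 1 := by
    rw [intervalIntegral.integral_const_mul, intervalIntegral.integral_sub (by simp)
      (by apply Continuous.intervalIntegrable; fun_prop), intervalIntegral.integral_const_mul,
      integral_id]
    norm_num
  linarith

lemma m_lower (β l : ℝ) (hβ : 0 < β) (hl : 2 * β + 4 ≤ l) :
    β ≤ l * mpart β l ^ 2 := by
  have hc := cpart_pos β l hβ
  have h := ibp1 β l hβ
  have hw := ww1_le β l hβ hl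
  have hm := mpart_pos β l hβ
  set a := mpart β l with ha
  have i1 := (intc β l a hβ).const_mul (-(a⁻¹)^2)
  have i2 := (int0 β l hβ).const_mul (a⁻¹)
  have h1 : ∫ x in (0:ℝ)..1, (-(a⁻¹)^2 * ((x - a) * ww β l x) + a⁻¹ * ww β l x)
      ≤ ∫ x in (0:ℝ)..1, x⁻¹ * ww β l x := by
    apply intervalIntegral.integral_mono_on_of_le_Ioo zero_le_one (i1.add i2)
      (int_inv β l hβ)
    intro x hx
    have hx0 := hx.1
    have : x⁻¹ - (-(a⁻¹)^2 * (x - a) + a⁻¹) = (x - a)^2 * (x⁻¹ * (a⁻¹)^2) := by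
      field_simp; ring
    have h0 : 0 ≤ (x - a)^2 * (x⁻¹ * (a⁻¹)^2) * ww β l x := by
      have := ww_pos β l x
      positivity
    rw [← this] at h0
    nlinarith
  rw [intervalIntegral.integral_add i1 i2, intervalIntegral.integral_const_mul,
    intervalIntegral.integral_const_mul, center β l a hβ, ← cpart_eq, ← ha] at h1
  have h2 := mul_le_mul_of_nonneg_left h1 hβ.le
  have : (β * a⁻¹) * cpart β l ≤ (l * a) * cpart β l := by linarith
  have h3 := le_of_mul_le_mul_right this hc
  rw [← div_eq_mul_inv, div_le_iff₀ hm] at h3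
  linarith

lemma m_lo (β l : ℝ) (hβ : 0 < β) (hl : 2 * β + 4 ≤ l) :
    √β / √l ≤ mpart β l := by
  have hl0 : 0 < l := by linarith
  have hm := mpart_pos β l hβ
  rw [← Real.sqrt_div hβ.le]
  apply Real.sqrt_le_iff.mpr ⟨hm.le, _⟩
  rw [div_le_iff₀ hl0]
  linarith [m_lower β l hβ hl]

lemma m_hi (β l : ℝ) (hβ : 0 < β) (hl : 2 * β + 4 ≤ l) :
    mpart β l ≤ √β / √l + 2 / l := by
  have hl0 : 0 < l := by linarith
  have hm := mpart_pos β l hβ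
  have hu := m_upper β l hβ hl0
  set s := √β / √l with hs
  have hs0 : 0 < s := by positivity
  have hs2 : l * s^2 = β := by
    rw [hs, div_pow, Real.sq_sqrt hβ.le, Real.sq_sqrt hl0.le]; field_simp
  have : l * (mpart β l - s) ≤ 2 := by
    by_contra! h
    nlinarith [mul_pos hm hs0]
  have : mpart β l - s ≤ 2 / l := by rw [le_div_iff₀ hl0]; linarith
  linarith

/-- Sum versus integral. -/
lemma sum_cmp (β l f : ℝ) (hβ : 0 < β) (hl : 0 < l) (hf : 0 ≤ f) (N : ℕ) (hN : 1 ≤ N) :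
    ∑ k ∈ Finset.Icc 1 N, √β / √(l + k * f) ≤ 2 * √β * N / (√(l + N * f) + √l) ∧
    2 * √β * N / (√(l + N * f) + √l) ≤
      ∑ k ∈ Finset.Icc 1 N, √β / √(l + k * f) + √β / √l := by
  rcases eq_or_lt_of_le hf with h0 | h0
  · subst h0
    have hb : 0 < √β := by positivity
    have : 0 < √l := by positivity
    have e : 2 * √β * N / (√l + √l) = N * (√β / √l) := by field_simp; ring
    simp only [mul_zero, add_zero, Finset.sum_const, Nat.card_Icc, Nat.add_sub_cancel, nsmul_eq_mul,
      e]
    exact ⟨le_rfl, by have : 0 < √β / √l := by positivity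
                      linarith⟩
  · have hb : 0 < √β := by positivity
    have hs : 0 < √l := by positivity
    have hp : ∀ k : ℕ, 0 < l + k * f := fun k => by positivity
    have hq : ∀ k : ℕ, 0 < √(l + k * f) := fun k => Real.sqrt_pos.mpr (hp k)
    have e : 2 * √β * N / (√(l + N * f) + √l) = 2 * √β * (√(l + N * f) - √l) / f := by
      have := hq N
      rw [div_eq_div_iff (by positivity) h0.ne']
      have h1 := Real.sq_sqrt (hp N).le
      have h2 := Real.sq_sqrt hl.le
      have : 2 * √β * (√(l + N * f) - √l) * (√(l + N * f) + √l)
        = 2 * √β * (√(l + N * f)^2 - √l^2) := by ring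
      rw [this, h1, h2]; ring
    have step : ∀ k : ℕ, √β / √(l + (k+1:ℕ) * f) ≤ 2 * √β * (√(l + (k+1:ℕ) * f) - √(l + k * f)) / f ∧
        2 * √β * (√(l + (k+1:ℕ) * f) - √(l + k * f)) / f ≤ √β / √(l + k * f) := by
      intro k
      have h1 := Real.sq_sqrt (hp k).le
      have h2 := Real.sq_sqrt (hp (k+1)).le
      have q1 := hq k
      have q2 := hq (k+1)
      have hfe : f = √(l + (k+1:ℕ) * f)^2 - √(l + k * f)^2 := by
        rw [h1, h2]; push_cast; ring
      have hle : √(l + k * f) ≤ √(l + (k+1:ℕ) * f) := by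
        apply Real.sqrt_le_sqrt; push_cast; linarith
      set a := √(l + k * f)
      set b := √(l + (k+1:ℕ) * f)
      constructor
      · rw [div_le_div_iff₀ q2 h0]
        have : 0 ≤ √β * (b - a)^2 := by positivity
        calc √β * f = √β * (b^2 - a^2) := by rw [← hfe]
          _ ≤ _ := by linarith
      · rw [div_le_div_iff₀ h0 q1]
        have : 0 ≤ √β * (b - a)^2 := by positivity
        calc _ ≤ √β * (b^2 - a^2) := by linarith
          _ = √β * f := by rw [← hfe]
    have main : ∀ n : ℕ, ∑ k ∈ Finset.Icc 1 n, √β / √(l + k * f) ≤ 2 * √β * (√(l + n * f) - √l) / f ∧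
      2 * √β * (√(l + n * f) - √l) / f + √β / √(l + n * f) ≤
      ∑ k ∈ Finset.Icc 1 n, √β / √(l + k * f) + √β / √l := by
      intro n
      induction n with
      | zero => simp
      | succ n ih =>
        rw [Finset.sum_Icc_succ_top (by omega)]
        obtain ⟨s1, s2⟩ := step n
        have e3 : 2 * √β * (√(l + (n+1:ℕ) * f) - √l) / f =
          2 * √β * (√(l + (n+1:ℕ) * f) - √(l + n * f)) / f + 2 * √β * (√(l + n * f) - √l) / f := by
          ring
        constructor <;> linarith [ih.1, ih.2]
    rw [e]
    refine ⟨(main N).1, ?_⟩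
    have : 0 < √β / √(l + N * f) := div_pos hb (hq N)
    linarith [(main N).2]

/-- Final algebra. -/
lemma final_alg (b A B f n T D : ℝ) (hb : 0 < b) (hA : 0 < A) (hB : 0 < B) (hf : 0 ≤ f)
    (hn : 0 < n) (hD : 0 < D) (hnD : 2 * D ≤ n) (hBA : B^2 = A^2 + n * f)
    (hT : T = 2 * b * n / (B + A)) (h1 : |T - 1| ≤ D / n) (hfn : f ≤ 2 * b^2 * n) :
    |A^2 / (b^2 * n^2 * (1 - f / (4 * b^2 * n))^2) - 1| ≤ (30 * D) / n := by
  have hDn : D / n ≤ 1/2 := by rw [div_le_iff₀ hn]; linarith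
  have hDn0 : 0 < D / n := by positivity
  set d := D / n with hd
  obtain ⟨t1, t2⟩ := abs_le.mp h1
  have hT0 : 1/2 ≤ T := by linarith
  have hTp : 0 < T := by linarith
  have e1 : B + A = 2 * b * n / T := by rw [hT]; field_simp
  have e2 : B - A = f * T / (2 * b) := by
    have : (B - A) * (B + A) = n * f := by nlinarith
    rw [e1] at this
    field_simp at this ⊢
    linarith
  set φ := f / (4 * b^2 * n) with hφ
  have hφ0 : 0 ≤ φ := by positivity
  have hφ1 : φ ≤ 1/2 := by rw [hφ, div_le_iff₀ (by positivity)]; linarith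
  set R := b * n * (1 - φ) with hR
  have hRp : b * n / 2 ≤ R := by
    have : 0 < b * n := by positivity
    nlinarith
  have hR0 : 0 < R := lt_of_lt_of_le (by positivity) hRp
  have e3 : A - R = b * n * ((1 - T) / T + φ * (1 - T)) := by
    have : A = b * n / T - f * T / (4 * b) := by
      have : A = ((B + A) - (B - A)) / 2 := by ring
      rw [this, e1, e2]; field_simp; ring
    rw [hR, this, hφ]; field_simp; ring
  have h2 : |(1 - T) / T + φ * (1 - T)| ≤ 3 * d := by
    have q : |1 - T| ≤ d := by rw [abs_sub_comm]; exact h1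
    have q1 : |(1 - T) / T| ≤ 2 * d := by
      rw [abs_div, abs_of_pos hTp, div_le_iff₀ hTp]; nlinarith
    have q2 : |φ * (1 - T)| ≤ d := by
      rw [abs_mul, abs_of_nonneg hφ0]; nlinarith [abs_nonneg (1 - T)]
    linarith [abs_add_le ((1 - T) / T) (φ * (1 - T))]
  have h3 : |(A - R) / R| ≤ 6 * d := by
    rw [abs_div, abs_of_pos hR0, div_le_iff₀ hR0, e3, abs_mul, abs_of_pos (by positivity)]
    have : 0 < b * n := by positivity
    calc b * n * |(1 - T) / T + φ * (1 - T)| ≤ b * n * (3 * d) := by gcongr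
      _ = 6 * d * (b * n / 2) := by ring
      _ ≤ 6 * d * R := by gcongr
  have e4 : A^2 / (b^2 * n^2 * (1 - φ)^2) - 1 = ((A - R)/R) * ((A - R)/R + 2) := by
    have : b^2 * n^2 * (1 - φ)^2 = R^2 := by rw [hR]; ring
    rw [this]; field_simp; ring
  rw [e4, abs_mul]
  have h4 : |(A - R)/R + 2| ≤ 5 := by
    have := abs_le.mp h3
    rw [abs_le]; constructor <;> linarith
  calc _ ≤ (6 * d) * 5 := by gcongr
    _ = 30 * D / n := by rw [hd]; ring

/-- Weak subcritical force: `λ(N) = β(1 − F(N)/(4βN))²N²(1 + O(1/N))`. -/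
theorem lambda_asymptotic_weak_subcritical (β : ℝ) (hβ : 0 < β)
    (F : ℕ → ℝ) (hF0 : ∀ N, 0 ≤ F N)
    (hF : Tendsto (fun N : ℕ => F N / N) atTop (nhds 0))
    (lam : ℕ → ℝ)
    (hlam : ∀ N : ℕ, 2 ≤ N →
      ∑ k ∈ Finset.Icc 1 N, mpart β (lam N + (k : ℝ) * F N) = 1) :
    ∃ C > (0:ℝ), ∃ N₀ : ℕ, ∀ N ≥ N₀,
      |lam N / (β * (N : ℝ) ^ 2 * (1 - F N / (4 * β * N)) ^ 2) - 1| ≤ C / N := by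
  have hb : 0 < √β := Real.sqrt_pos.mpr hβ
  have hb2 : √β ^ 2 = β := Real.sq_sqrt hβ.le
  set D : ℝ := 2 + 4 / β with hD
  have hD0 : 0 < D := by positivity
  refine ⟨30 * D, by positivity, ?_⟩
  have c1 : ∀ᶠ N : ℕ in atTop, F N / N < β / 2 := hF.eventually_lt_const (by positivity)
  have hm0 := mpart_pos β (2 * β + 4) hβ
  have c2 : ∀ᶠ N : ℕ in atTop, max 2 (max (2 * D) (max (2 * (2 * β + 4) / β)
      (2 / mpart β (2 * β + 4)))) ≤ (N : ℝ) :=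
    tendsto_natCast_atTop_atTop.eventually_ge_atTop _
  obtain ⟨N₀, hN₀⟩ := eventually_atTop.mp (c1.and c2)
  refine ⟨N₀, fun N hN => ?_⟩
  obtain ⟨hFN, hmax⟩ := hN₀ N hN
  simp only [max_le_iff] at hmax
  obtain ⟨hN2, hND, hNb, hNm⟩ := hmax
  have hN2' : 2 ≤ N := by exact_mod_cast hN2
  have hsum := hlam N hN2'
  have hf0 := hF0 N
  set l := lam N
  set f := F N
  have hn : (0:ℝ) < N := by linarith
  have hfn : f ≤ β / 2 * N := ((div_lt_iff₀ hn).mp hFN).le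
  have anti := mpart_anti β hβ
  have hmN : mpart β (l + N * f) ≤ 1 / N := by
    rw [le_div_iff₀ hn, ← hsum]
    calc mpart β (l + N * f) * N = ∑ k ∈ Finset.Icc 1 N, mpart β (l + N * f) := by
          simp [mul_comm]
      _ ≤ _ := by
          apply Finset.sum_le_sum
          intro k hk
          apply anti
          have : (k:ℝ) ≤ N := by exact_mod_cast (Finset.mem_Icc.mp hk).2
          gcongr
  have hbig : 2 * β + 4 ≤ l + N * f := by
    by_contra! h
    have h1 := anti h.le
    have h2 : mpart β (2 * β + 4) ≤ 1 / N := h1.trans hmN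
    rw [le_div_iff₀ hn] at h2
    rw [div_le_iff₀ hm0] at hNm
    linarith
  have hlN : β * N^2 ≤ l + N * f := by
    have h1 := m_lower β _ hβ hbig
    have h2 := mpart_pos β (l + N * f) hβ
    have h3 : mpart β (l + N * f) ^ 2 ≤ (1 / N)^2 := by gcongr
    have h4 : β ≤ (l + N * f) * (1 / N)^2 :=
      h1.trans (mul_le_mul_of_nonneg_left h3 (by linarith))
    calc β * N^2 ≤ (l + N * f) * (1 / N)^2 * N^2 := by gcongr
      _ = _ := by field_simp
  have hl : β / 2 * N^2 ≤ l := by nlinarith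
  have hl4 : 2 * β + 4 ≤ l := by
    rw [div_le_iff₀ hβ] at hNb
    have : (N:ℝ) * β ≤ N^2 * β := by
      apply mul_le_mul_of_nonneg_right _ hβ.le
      nlinarith
    nlinarith
  have hl0 : 0 < l := by linarith
  obtain ⟨s1, s2⟩ := sum_cmp β l f hβ hl0 hf0 N (by omega)
  have hkl : ∀ k : ℕ, l ≤ l + k * f := fun k => by
    have : 0 ≤ (k:ℝ) * f := by positivity
    linarith
  have u1 : ∑ k ∈ Finset.Icc 1 N, √β / √(l + k * f) ≤ 1 := by
    rw [← hsum]
    apply Finset.sum_le_sum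
    intro k _
    exact m_lo β _ hβ (hl4.trans (hkl k))
  have u2 : 1 ≤ ∑ k ∈ Finset.Icc 1 N, √β / √(l + k * f) + 4 / β / N := by
    have h1 : 1 ≤ ∑ k ∈ Finset.Icc 1 N, (√β / √(l + k * f) + 2 / l) := by
      rw [← hsum]
      apply Finset.sum_le_sum
      intro k _
      refine (m_hi β _ hβ (hl4.trans (hkl k))).trans ?_
      gcongr
      exact hkl k
    rw [Finset.sum_add_distrib] at h1
    have h2 : ∑ k ∈ Finset.Icc 1 N, 2 / l ≤ 4 / β / N := by
      simp only [Finset.sum_const, Nat.card_Icc, Nat.add_sub_cancel, nsmul_eq_mul]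
      calc (N:ℝ) * (2 / l) ≤ N * (2 / (β / 2 * N^2)) := by gcongr
        _ = _ := by field_simp; norm_num
    linarith
  have u3 : √β / √l ≤ 2 / N := by
    rw [← Real.sqrt_div hβ.le]
    apply Real.sqrt_le_iff.mpr ⟨by positivity, ?_⟩
    rw [div_le_iff₀ hl0]
    calc β ≤ (2 / N)^2 * (β / 2 * N^2) := by field_simp; norm_num
      _ ≤ _ := by gcongr
  have hT : |2 * √β * N / (√(l + N * f) + √l) - 1| ≤ D / N := by
    have e : D / N = 2 / N + 4 / β / N := by rw [hD]; ring
    have p1 : 0 < 2 / (N:ℝ) := by positivity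
    have p2 : 0 < 4 / β / (N:ℝ) := by positivity
    rw [abs_le, e]
    constructor <;> linarith
  have hlN0 : 0 < l + N * f := by linarith
  have := final_alg (√β) (√l) (√(l + N * f)) f N _ D hb (Real.sqrt_pos.mpr hl0)
    (Real.sqrt_pos.mpr hlN0) hf0 hn hD0 hND
    (by rw [Real.sq_sqrt hl0.le, Real.sq_sqrt hlN0.le]) rfl hT (by rw [hb2]; nlinarith)
  rw [hb2, Real.sq_sqrt hl0.le] at this
  exact this
end
end
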